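/- Let N ≥ 1, and for i = 1, …, N let φᵢ : ℝⁿ → ℝ be twice continuously differentiable with ‖∇²φᵢ(x)‖ ≤ L for all x ∈ ℝⁿ, and let bᵢ ∈ ℝ. Define f(x) = (1/2)·Σᵢ₌₁ᴺ (φᵢ(x) − bᵢ)² and H(x) = Σᵢ₌₁ᴺ ∇φᵢ(x)∇φᵢ(x)ᵀ. Suppose f is star-convex with respect to a global minimizer x_* and the problem is overparametrized, i.e. f(x_*) = 0. Then for every x ∈ ℝⁿ, ‖∇²f(x) − H(x)‖ ≤ L·√(2N·‖∇f(x)‖·‖x − x_*‖); in particular, on any set where ‖x − x_*‖ is bounded, ‖∇²f(x) − H(x)‖ is bounded by a constant multiple of ‖∇f(x)‖^{1/2}. -/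

import Mathlib

open RealInnerProductSpace

section GaussNewton

variable {E : Type*} [NormedAddCommGroup E] [InnerProductSpace ℝ E] [CompleteSpace E]

theorem ContDiff.differentiable_gradient {g : E → ℝ} (hg : ContDiff ℝ 2 g) :
    Differentiable ℝ (gradient g) := by
  have h : Differentiable ℝ (fderiv ℝ g) :=
    (hg.fderiv_right (m := 1) (by norm_num)).differentiable (by norm_num)
  exact (InnerProductSpace.toDual ℝ E).symm.toContinuousLinearEquiv.differentiable.comp h

theorem hasGradientAt_half_sum_sq {ι : Type*} [Fintype ι] {r : ι → E → ℝ} {r' : ι → E} {x : E}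
    (hr : ∀ i, HasGradientAt (r i) (r' i) x) :
    HasGradientAt (fun y => 1 / 2 * ∑ i, (r i y) ^ 2) (∑ i, r i x • r' i) x := by
  rw [hasGradientAt_iff_hasFDerivAt]
  have h := (HasFDerivAt.fun_sum (u := Finset.univ)
    fun i _ => ((hr i).hasFDerivAt).pow 2).const_mul (1 / 2 : ℝ)
  refine h.congr_fderiv ?_
  ext v
  simp [Finset.mul_sum]
  refine Finset.sum_congr rfl fun i _ => ?_
  ring

theorem fderiv_sum_smul_gradient_apply {ι : Type*} [Fintype ι] {φ : ι → E → ℝ}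
    (hφ : ∀ i, ContDiff ℝ 2 (φ i)) (b : ι → ℝ) (x v : E) :
    fderiv ℝ (fun y => ∑ i, (φ i y - b i) • gradient (φ i) y) x v
      = ∑ i, ⟪gradient (φ i) x, v⟫ • gradient (φ i) x
        + ∑ i, (φ i x - b i) • fderiv ℝ (gradient (φ i)) x v := by
  have hd : ∀ i, DifferentiableAt ℝ (φ i) x := fun i =>
    (hφ i).differentiable (by norm_num) x
  have h := HasFDerivAt.fun_sum (u := Finset.univ) fun i _ =>
    (((hd i).hasGradientAt.hasFDerivAt).sub_const (b i)).smul
      ((hφ i).differentiable_gradient x).hasFDerivAt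
  have h' := h.fderiv
  simp only [Pi.smul_apply'] at h'
  rw [h']
  simp [Finset.sum_add_distrib, add_comm]

theorem sum_abs_le_sqrt_card_mul_sum_sq {ι : Type*} [Fintype ι] (r : ι → ℝ) :
    ∑ i, |r i| ≤ Real.sqrt (Fintype.card ι * ∑ i, (r i) ^ 2) := by
  apply Real.le_sqrt_of_sq_le
  simpa using sq_sum_le_card_mul_sum_sq (s := Finset.univ) (f := fun i => |r i|)

end GaussNewton

/-- Gauss–Newton approximation error for overparametrized star-convex least-squares
objectives: `‖∇²f(x) − H(x)‖ ≤ L√(2N‖∇f(x)‖‖x − x_*‖)`; in particular, on any set where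
`‖x − x_*‖` is bounded, `‖∇²f(x) − H(x)‖` is bounded by a constant multiple of
`‖∇f(x)‖^{1/2}`. -/
theorem stmt16 {n : ℕ} (N : ℕ) (hN : 1 ≤ N) (L : ℝ)
    (φ : Fin N → EuclideanSpace ℝ (Fin n) → ℝ) (b : Fin N → ℝ)
    (hφ : ∀ i, ContDiff ℝ 2 (φ i))
    (hHessφ : ∀ i x, ‖fderiv ℝ (gradient (φ i)) x‖ ≤ L)
    (f : EuclideanSpace ℝ (Fin n) → ℝ)
    (hfdef : ∀ x, f x = 1 / 2 * ∑ i, (φ i x - b i) ^ 2)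
    (H : EuclideanSpace ℝ (Fin n) →
      EuclideanSpace ℝ (Fin n) →L[ℝ] EuclideanSpace ℝ (Fin n))
    (hHdef : ∀ x v, H x v = ∑ i, ⟪gradient (φ i) x, v⟫ • gradient (φ i) x)
    (xstar : EuclideanSpace ℝ (Fin n)) (hmin : ∀ y, f xstar ≤ f y)
    (hstar : ∀ x, f xstar ≥ f x + ⟪gradient f x, xstar - x⟫)
    (hover : f xstar = 0) :
    (∀ x, ‖fderiv ℝ (gradient f) x - H x‖
        ≤ L * Real.sqrt (2 * N * ‖gradient f x‖ * ‖x - xstar‖)) ∧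
    (∀ R > (0 : ℝ), ∃ C : ℝ, ∀ x, ‖x - xstar‖ ≤ R →
        ‖fderiv ℝ (gradient f) x - H x‖ ≤ C * ‖gradient f x‖ ^ ((1 : ℝ) / 2)) := by
  have hL : 0 ≤ L := (norm_nonneg _).trans (hHessφ ⟨0, hN⟩ xstar)
  have hgrad : gradient f = fun x => ∑ i, (φ i x - b i) • gradient (φ i) x := by
    funext x
    rw [funext hfdef]
    refine (hasGradientAt_half_sum_sq fun i => ?_).gradient
    have hd := ((hφ i).differentiable (by norm_num) x).hasGradientAt
    rw [hasGradientAt_iff_hasFDerivAt] at hd ⊢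
    exact hd.sub_const (b i)
  have hdiff : ∀ x, fderiv ℝ (gradient f) x - H x
      = ∑ i, (φ i x - b i) • fderiv ℝ (gradient (φ i)) x := by
    intro x
    refine ContinuousLinearMap.ext fun v => ?_
    rw [sub_apply, hHdef, hgrad, fderiv_sum_smul_gradient_apply hφ]
    simp
  have hbound : ∀ x, ‖fderiv ℝ (gradient f) x - H x‖
      ≤ L * Real.sqrt (2 * N * ‖gradient f x‖ * ‖x - xstar‖) := by
    intro x
    have hfx : f x ≤ ‖gradient f x‖ * ‖x - xstar‖ := by
      have h₁ := hstar x
      have h₂ := real_inner_le_norm (gradient f x) (x - xstar)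
      rw [← neg_sub x xstar, inner_neg_right] at h₁
      linarith
    have hsq : ∑ i, (φ i x - b i) ^ 2 = 2 * f x := by
      rw [hfdef]
      ring
    calc ‖fderiv ℝ (gradient f) x - H x‖
        ≤ ∑ i, ‖(φ i x - b i) • fderiv ℝ (gradient (φ i)) x‖ := by
          rw [hdiff]
          exact norm_sum_le _ _
      _ ≤ ∑ i, L * |φ i x - b i| := by
          refine Finset.sum_le_sum fun i _ => ?_
          rw [norm_smul, Real.norm_eq_abs, mul_comm]
          exact mul_le_mul_of_nonneg_right (hHessφ i x) (abs_nonneg _)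
      _ = L * ∑ i, |φ i x - b i| := by rw [Finset.mul_sum]
      _ ≤ L * Real.sqrt (N * (2 * f x)) := by
          refine mul_le_mul_of_nonneg_left ?_ hL
          simpa [hsq] using sum_abs_le_sqrt_card_mul_sum_sq fun i => φ i x - b i
      _ ≤ L * Real.sqrt (2 * N * ‖gradient f x‖ * ‖x - xstar‖) := by
          refine mul_le_mul_of_nonneg_left (Real.sqrt_le_sqrt ?_) hL
          have := mul_le_mul_of_nonneg_left hfx (by positivity : (0 : ℝ) ≤ 2 * N)
          linarith
  refine ⟨hbound, fun R hR => ⟨L * Real.sqrt (2 * N * R), fun x hx => ?_⟩⟩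
  refine (hbound x).trans ?_
  rw [← Real.sqrt_eq_rpow, mul_assoc L, ← Real.sqrt_mul (by positivity)]
  refine mul_le_mul_of_nonneg_left (Real.sqrt_le_sqrt ?_) hL
  rw [mul_right_comm]
  gcongr
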